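/- Let Y be a ℤ-module generated by a family (v_i)_{i ∈ I}, and for each i let f_i : Y → ℤ be a ℤ-linear map with f_i(v_i) = 2. Let Q : Y → ℤ be a quadratic map invariant under each reflection s_i(y) = y − f_i(y) • v_i. Let n be a positive integer and set n_i = n / gcd(n, Q(v_i)). Then for every y ∈ Y: y ∈ Y_{Q,n} if and only if n_i divides f_i(y) for all i ∈ I. (This is the paper's characterization (YQnCharacterization) of Y_{Q,n} for simply-connected groups: y ∈ Y_{Q,n} iff ⟨α_i, y⟩ ∈ n_i ℤ for all simple roots α_i.) -/

import Mathlib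

/-- The polar form `B_Q(y₁, y₂) = Q(y₁ + y₂) − Q(y₁) − Q(y₂)` of a map `Q : Y → ℤ`. -/
def polarForm {Y : Type*} [AddCommGroup Y] (Q : Y → ℤ) (y₁ y₂ : Y) : ℤ :=
  Q (y₁ + y₂) - Q y₁ - Q y₂

/-- `Q : Y → ℤ` is a quadratic map: `Q(k • y) = k² Q(y)` and the polar form is
additive (hence, by symmetry, ℤ-bilinear). -/
def IsQuadraticMap {Y : Type*} [AddCommGroup Y] (Q : Y → ℤ) : Prop :=
  (∀ (k : ℤ) (y : Y), Q (k • y) = k ^ 2 * Q y) ∧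
  (∀ y₁ y₂ y₃ : Y, polarForm Q (y₁ + y₂) y₃ = polarForm Q y₁ y₃ + polarForm Q y₂ y₃)

/-- The sublattice `Y_{Q,n} = {y : n ∣ B_Q(y, y′) for all y′}`. -/
def latticeQn {Y : Type*} [AddCommGroup Y] (Q : Y → ℤ) (n : ℕ) : Set Y :=
  {y : Y | ∀ y' : Y, (n : ℤ) ∣ polarForm Q y y'}

theorem polarForm_comm {Y : Type*} [AddCommGroup Y] (Q : Y → ℤ) (y z : Y) :
    polarForm Q y z = polarForm Q z y := by
  simp only [polarForm, add_comm y z]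
  ring

namespace IsQuadraticMap

variable {Y : Type*} [AddCommGroup Y] {Q : Y → ℤ}

/-- The polar form of a quadratic map, as a linear map in the first variable. -/
def polarLinear (hQ : IsQuadraticMap Q) (z : Y) : Y →ₗ[ℤ] ℤ :=
  (AddMonoidHom.mk' (fun y => polarForm Q y z) fun y₁ y₂ => hQ.2 y₁ y₂ z).toIntLinearMap

theorem polarLinear_apply (hQ : IsQuadraticMap Q) (y z : Y) :
    hQ.polarLinear z y = polarForm Q y z := rfl

theorem polarForm_zsmul_left (hQ : IsQuadraticMap Q) (k : ℤ) (y z : Y) :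
    polarForm Q (k • y) z = k * polarForm Q y z := by
  simpa only [smul_eq_mul, polarLinear_apply] using (hQ.polarLinear z).map_smul k y

theorem polarForm_self (hQ : IsQuadraticMap Q) (y : Y) : polarForm Q y y = 2 * Q y := by
  have h := hQ.1 2 y
  rw [two_smul] at h
  rw [polarForm, h]
  ring

/-- Invariance of `Q` under the reflection attached to `(v, f)` determines the polar form
against `v`. -/
theorem polarForm_eq_mul_of_reflection_invariant (hQ : IsQuadraticMap Q) {v : Y}
    {f : Y →ₗ[ℤ] ℤ} (hfv : f v = 2) (hinv : ∀ y, Q (y - f y • v) = Q y) (y : Y) :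
    polarForm Q y v = f y * Q v := by
  have key (z : Y) (hz : f z ≠ 0) : polarForm Q z v = f z * Q v := by
    have h₁ : polarForm Q (-f z • v) z = -f z * polarForm Q v z :=
      hQ.polarForm_zsmul_left _ _ _
    rw [polarForm, hQ.1, show -f z • v + z = z - f z • v by rw [neg_smul]; abel, hinv,
      polarForm_comm] at h₁
    apply mul_left_cancel₀ hz
    linear_combination h₁
  by_cases hy : f y = 0
  · have h := key (y + v) (by simp [hy, hfv])
    rw [hQ.2, hQ.polarForm_self, map_add, hy, hfv] at h
    rw [hy]
    linear_combination h
  · exact key y hy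

end IsQuadraticMap

theorem natCast_dvd_mul_iff_div_gcd_dvd {n : ℕ} (hn : 0 < n) (a q : ℤ) :
    (n : ℤ) ∣ a * q ↔ ((n / Int.gcd (n : ℤ) q : ℕ) : ℤ) ∣ a := by
  rw [Int.natCast_dvd, Int.natCast_dvd, Int.natAbs_mul]
  change n ∣ _ ↔ n / Nat.gcd n q.natAbs ∣ _
  have hg : 0 < Nat.gcd n q.natAbs := Nat.gcd_pos_of_pos_left _ hn
  rw [← (Nat.coprime_div_gcd_div_gcd hg).dvd_mul_right,
    ← Nat.mul_dvd_mul_iff_right (a := n / Nat.gcd n q.natAbs) hg, mul_assoc,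
    Nat.div_mul_cancel (Nat.gcd_dvd_left _ _), Nat.div_mul_cancel (Nat.gcd_dvd_right _ _)]

/-- (YQnCharacterization): if `Y` is generated by coroots `v i` with roots `f i`
(`f i (v i) = 2`) and `Q` is invariant under all the associated reflections, then
`y ∈ Y_{Q,n}` if and only if `n_i ∣ f i (y)` for all `i`, where
`n_i = n / gcd(n, Q(v i))`. -/
theorem YQn_characterization {Y : Type*} [AddCommGroup Y] {I : Type*}
    (v : I → Y) (f : I → (Y →ₗ[ℤ] ℤ))
    (hspan : Submodule.span ℤ (Set.range v) = ⊤)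
    (hfv : ∀ i : I, f i (v i) = 2)
    (Q : Y → ℤ) (hQ : IsQuadraticMap Q)
    (hinv : ∀ i : I, ∀ y : Y, Q (y - f i y • v i) = Q y)
    (n : ℕ) (hn : 0 < n) :
    ∀ y : Y, y ∈ latticeQn Q n ↔
      ∀ i : I, ((n / Int.gcd (n : ℤ) (Q (v i)) : ℕ) : ℤ) ∣ f i y := by
  intro y
  have hpolar (i : I) : polarForm Q y (v i) = f i y * Q (v i) :=
    hQ.polarForm_eq_mul_of_reflection_invariant (hfv i) (hinv i) y
  simp only [← natCast_dvd_mul_iff_div_gcd_dvd hn, ← hpolar]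
  refine ⟨fun h i => h (v i), fun h y' => ?_⟩
  have hle : Submodule.span ℤ (Set.range v) ≤
      Submodule.comap (hQ.polarLinear y) (Ideal.span {(n : ℤ)}) := by
    rw [Submodule.span_le]
    rintro _ ⟨i, rfl⟩
    exact Ideal.mem_span_singleton.mpr (by
      rw [hQ.polarLinear_apply, polarForm_comm]
      exact h i)
  have hy' : y' ∈ Submodule.span ℤ (Set.range v) := hspan ▸ Submodule.mem_top
  rw [polarForm_comm, ← hQ.polarLinear_apply]
  exact Ideal.mem_span_singleton.mp (hle hy')
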